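/- arXiv:0908.2604 — 4 statements merged into one kernel-verified Lean document; each statement's English description precedes it below -/
import Mathlib

section
/- Let V denote a finite-dimensional irreducible T-module. Then: (i) there exist nonnegative integers r and δ with r+δ ≤ d such that e*_i V ≠ 0 if and only if r ≤ i ≤ r+δ (0 ≤ i ≤ d); (ii) there exist nonnegative integers t and δ* with t+δ* ≤ d such that e_i V ≠ 0 if and only if t ≤ i ≤ t+δ* (0 ≤ i ≤ d). -/
open Polynomial

noncomputable section

/-- The polynomial `τ_i = (λ−θ_0)(λ−θ_1)⋯(λ−θ_{i−1})`. -/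
def tauPoly {F : Type*} [Field F] (θ : ℕ → F) (i : ℕ) : Polynomial F :=
  ∏ j ∈ Finset.range i, (X - C (θ j))

/-- The polynomial `η_i = (λ−θ_d)(λ−θ_{d−1})⋯(λ−θ_{d−i+1})`. -/
def etaPoly {F : Type*} [Field F] (d : ℕ) (θ : ℕ → F) (i : ℕ) : Polynomial F :=
  ∏ j ∈ Finset.range i, (X - C (θ (d - j)))

/-- Generators of the algebra `T`: `a`, `a*`, `e_0,…,e_d`, `e*_0,…,e*_d`. -/
inductive TGen (d : ℕ) : Type
  | a : TGen d
  | astar : TGen d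
  | e : Fin (d + 1) → TGen d
  | estar : Fin (d + 1) → TGen d

/-- The defining relations of the algebra `T`. -/
inductive TRel (F : Type*) [Field F] (d : ℕ) (θ θs : ℕ → F) :
    FreeAlgebra F (TGen d) → FreeAlgebra F (TGen d) → Prop
  | ee (i j : Fin (d + 1)) :
      TRel F d θ θs (FreeAlgebra.ι F (TGen.e i) * FreeAlgebra.ι F (TGen.e j))
        (if i = j then FreeAlgebra.ι F (TGen.e i) else 0)
  | eses (i j : Fin (d + 1)) :
      TRel F d θ θs (FreeAlgebra.ι F (TGen.estar i) * FreeAlgebra.ι F (TGen.estar j))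
        (if i = j then FreeAlgebra.ι F (TGen.estar i) else 0)
  | sum_e : TRel F d θ θs (∑ i : Fin (d + 1), FreeAlgebra.ι F (TGen.e i)) 1
  | sum_estar : TRel F d θ θs (∑ i : Fin (d + 1), FreeAlgebra.ι F (TGen.estar i)) 1
  | a_eq : TRel F d θ θs (FreeAlgebra.ι F TGen.a)
      (∑ i : Fin (d + 1), θ (i : ℕ) • FreeAlgebra.ι F (TGen.e i))
  | astar_eq : TRel F d θ θs (FreeAlgebra.ι F TGen.astar)
      (∑ i : Fin (d + 1), θs (i : ℕ) • FreeAlgebra.ι F (TGen.estar i))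
  | trid (i j : Fin (d + 1)) (k : ℕ) (hk : k ≤ d)
      (h : k < max ((i : ℕ) - (j : ℕ)) ((j : ℕ) - (i : ℕ))) :
      TRel F d θ θs (FreeAlgebra.ι F (TGen.estar i) * FreeAlgebra.ι F TGen.a ^ k *
        FreeAlgebra.ι F (TGen.estar j)) 0
  | tridstar (i j : Fin (d + 1)) (k : ℕ) (hk : k ≤ d)
      (h : k < max ((i : ℕ) - (j : ℕ)) ((j : ℕ) - (i : ℕ))) :
      TRel F d θ θs (FreeAlgebra.ι F (TGen.e i) * FreeAlgebra.ι F TGen.astar ^ k *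
        FreeAlgebra.ι F (TGen.e j)) 0

/-- The `F`-algebra `T` presented by the above generators and relations. -/
abbrev TAlg (F : Type*) [Field F] (d : ℕ) (θ θs : ℕ → F) : Type _ :=
  RingQuot (TRel F d θ θs)

/-- The image in `T` of a generator. -/
def tgen (F : Type*) [Field F] (d : ℕ) (θ θs : ℕ → F) (g : TGen d) : TAlg F d θ θs :=
  RingQuot.mkAlgHom F (TRel F d θ θs) (FreeAlgebra.ι F g)

/-- The element `a` of `T`. -/
def aT (F : Type*) [Field F] (d : ℕ) (θ θs : ℕ → F) : TAlg F d θ θs :=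
  tgen F d θ θs TGen.a

/-- The element `a*` of `T`. -/
def asT (F : Type*) [Field F] (d : ℕ) (θ θs : ℕ → F) : TAlg F d θ θs :=
  tgen F d θ θs TGen.astar

/-- The element `e_i` of `T` (defined to be `0` for `i > d`). -/
def eT (F : Type*) [Field F] (d : ℕ) (θ θs : ℕ → F) (i : ℕ) : TAlg F d θ θs :=
  if h : i < d + 1 then tgen F d θ θs (TGen.e ⟨i, h⟩) else 0

/-- The element `e*_i` of `T` (defined to be `0` for `i > d`). -/
def esT (F : Type*) [Field F] (d : ℕ) (θ θs : ℕ → F) (i : ℕ) : TAlg F d θ θs :=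
  if h : i < d + 1 then tgen F d θ θs (TGen.estar ⟨i, h⟩) else 0

/-- Conditions (i) and (iii): the `θ_i` are mutually distinct, the `θ*_i` are mutually
distinct, and the expressions `(θ_{i-2}−θ_{i+1})/(θ_{i-1}−θ_i)`,
`(θ*_{i-2}−θ*_{i+1})/(θ*_{i-1}−θ*_i)` are equal and independent of `i` for `2 ≤ i ≤ d−1`. -/
def EigCond (F : Type*) [Field F] (d : ℕ) (θ θs : ℕ → F) : Prop :=
  (∀ i j, i ≤ d → j ≤ d → i ≠ j → θ i ≠ θ j) ∧
  (∀ i j, i ≤ d → j ≤ d → i ≠ j → θs i ≠ θs j) ∧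
  ∃ β : F, ∀ i, 2 ≤ i → i + 1 ≤ d →
    θ (i - 2) - θ (i + 1) = β * (θ (i - 1) - θ i) ∧
    θs (i - 2) - θs (i + 1) = β * (θs (i - 1) - θs i)

/-- The subalgebra `D` of `T` generated by `a`, as an `F`-subspace. -/
def Dsub (F : Type*) [Field F] (d : ℕ) (θ θs : ℕ → F) : Submodule F (TAlg F d θ θs) :=
  Subalgebra.toSubmodule (Algebra.adjoin F {aT F d θ θs})

/-- The subalgebra `D*` of `T` generated by `a*`, as an `F`-subspace. -/
def DsSub (F : Type*) [Field F] (d : ℕ) (θ θs : ℕ → F) : Submodule F (TAlg F d θ θs) :=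
  Subalgebra.toSubmodule (Algebra.adjoin F {asT F d θ θs})

end

noncomputable section

/-- A tridiagonal system on `V` of diameter `d`, with data `(A; {E_i}; A*; {E*_i})`,
eigenvalue sequence `θ` and dual eigenvalue sequence `θs`.  The families `E`, `Es` are the
orderings of the primitive idempotents of `A`, `A*` (so the `E_i V` are the eigenspaces of the
diagonalizable map `A`, ordered so that the tridiagonal conditions hold, and similarly for
`A*`), and the last condition is the irreducibility condition (iv). -/
def IsTDSystem (F : Type*) [Field F] (V : Type*) [AddCommGroup V] [Module F V]
    (d : ℕ) (A As : V →ₗ[F] V) (E Es : ℕ → (V →ₗ[F] V)) (θ θs : ℕ → F) : Prop :=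
  FiniteDimensional F V ∧ 0 < Module.finrank F V ∧
  (∀ i j, i ≤ d → j ≤ d → i ≠ j → θ i ≠ θ j) ∧
  (∀ i j, i ≤ d → j ≤ d → i ≠ j → θs i ≠ θs j) ∧
  (∀ i, i ≤ d → E i ≠ 0) ∧
  (∀ i, i ≤ d → Es i ≠ 0) ∧
  (∀ i j, i ≤ d → j ≤ d → E i ∘ₗ E j = if i = j then E i else 0) ∧
  (∀ i j, i ≤ d → j ≤ d → Es i ∘ₗ Es j = if i = j then Es i else 0) ∧
  (∑ i ∈ Finset.range (d + 1), E i) = LinearMap.id ∧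
  (∑ i ∈ Finset.range (d + 1), Es i) = LinearMap.id ∧
  A = ∑ i ∈ Finset.range (d + 1), θ i • E i ∧
  As = ∑ i ∈ Finset.range (d + 1), θs i • Es i ∧
  (∀ i, i ≤ d → Submodule.map As (LinearMap.range (E i)) ≤
    (if i = 0 then ⊥ else LinearMap.range (E (i - 1))) ⊔ LinearMap.range (E i) ⊔
      (if i = d then ⊥ else LinearMap.range (E (i + 1)))) ∧
  (∀ i, i ≤ d → Submodule.map A (LinearMap.range (Es i)) ≤
    (if i = 0 then ⊥ else LinearMap.range (Es (i - 1))) ⊔ LinearMap.range (Es i) ⊔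
      (if i = d then ⊥ else LinearMap.range (Es (i + 1)))) ∧
  (∀ W : Submodule F V, (∀ w ∈ W, A w ∈ W) → (∀ w ∈ W, As w ∈ W) → W = ⊥ ∨ W = ⊤)

/-- A sharp tridiagonal system with parameter array `(θ; θs; ζ)`:  a tridiagonal system
which is sharp (`dim E*_0 V = 1`) and whose split sequence is `ζ`, i.e.
`E*_0 τ_i(A) E*_0 = ζ_i E*_0 / ((θ*_0−θ*_1)⋯(θ*_0−θ*_i))` for `0 ≤ i ≤ d`. -/
def SharpTDWithArray (F : Type*) [Field F] (V : Type*) [AddCommGroup V] [Module F V]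
    (d : ℕ) (A As : V →ₗ[F] V) (E Es : ℕ → (V →ₗ[F] V)) (θ θs ζ : ℕ → F) : Prop :=
  IsTDSystem F V d A As E Es θ θs ∧
  Module.finrank F (LinearMap.range (Es 0)) = 1 ∧
  ∀ i, i ≤ d → Es 0 ∘ₗ (Polynomial.aeval A (tauPoly θ i)) ∘ₗ Es 0 =
    (ζ i / ∏ h ∈ Finset.Icc 1 i, (θs 0 - θs h)) • Es 0

/-- The action of an element `x` of `T` on a `T`-module `M`, as an `F`-linear map. -/
def actL {F : Type*} [Field F] {d : ℕ} {θ θs : ℕ → F} {M : Type*} [AddCommGroup M]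
    [Module F M] [Module (TAlg F d θ θs) M] [IsScalarTower F (TAlg F d θ θs) M]
    (x : TAlg F d θ θs) : M →ₗ[F] M where
  toFun m := x • m
  map_add' := smul_add x
  map_smul' c m := (smul_comm c x m).symm

/-- The `F`-linear map `T → M`, `t ↦ t • v`, for a vector `v` of a `T`-module `M`. -/
def applyVec {F : Type*} [Field F] {d : ℕ} {θ θs : ℕ → F} {M : Type*} [AddCommGroup M]
    [Module F M] [Module (TAlg F d θ θs) M] [IsScalarTower F (TAlg F d θ θs) M]
    (v : M) : TAlg F d θ θs →ₗ[F] M where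
  toFun t := t • v
  map_add' x y := add_smul x y v
  map_smul' c t := smul_assoc c t v

/-- The `F`-subspace `e*_0 T e*_0` of `T`. -/
def corner (F : Type*) [Field F] (d : ℕ) (θ θs : ℕ → F) : Submodule F (TAlg F d θ θs) :=
  LinearMap.range ((LinearMap.mulLeft F (esT F d θ θs 0)).comp
    (LinearMap.mulRight F (esT F d θ θs 0)))

/-- The properties characterizing the homomorphism `μ : F[x_1,…,x_d] → e*_0 T e*_0`:
it is `F`-linear, unital (with `1 ↦ e*_0`, the identity of `e*_0Te*_0`), multiplicative,
sends `x_i ↦ e*_0 τ_i(a) e*_0` for `1 ≤ i ≤ d`, and is onto `e*_0 T e*_0`. -/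
def MuProps (F : Type*) [Field F] (d : ℕ) (θ θs : ℕ → F)
    (μ : MvPolynomial (Fin d) F →ₗ[F] TAlg F d θ θs) : Prop :=
  μ 1 = esT F d θ θs 0 ∧
  (∀ p q, μ (p * q) = μ p * μ q) ∧
  (∀ i : Fin d, μ (MvPolynomial.X i) =
    esT F d θ θs 0 * (Polynomial.aeval (aT F d θ θs) (tauPoly θ ((i : ℕ) + 1))) *
      esT F d θ θs 0) ∧
  LinearMap.range μ = corner F d θ θs

/-- Conditions (ii) on the split sequence: `ζ_0 = 1`, `ζ_d ≠ 0` and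
`Σ_{i=0}^d η_{d−i}(θ_0) η*_{d−i}(θ*_0) ζ_i ≠ 0`. -/
def ZetaCond (F : Type*) [Field F] (d : ℕ) (θ θs : ℕ → F) (ζ : ℕ → F) : Prop :=
  ζ 0 = 1 ∧ ζ d ≠ 0 ∧
  (∑ i ∈ Finset.range (d + 1),
    (etaPoly d θ (d - i)).eval (θ 0) * (etaPoly d θs (d - i)).eval (θs 0) * ζ i) ≠ 0

/-- The element `g_i = e*_0 τ_i(a) e*_0 − ζ_i e*_0/((θ*_0−θ*_1)⋯(θ*_0−θ*_i))` of `T`. -/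
def gElt (F : Type*) [Field F] (d : ℕ) (θ θs : ℕ → F) (ζ : ℕ → F) (i : ℕ) :
    TAlg F d θ θs :=
  esT F d θ θs 0 * (Polynomial.aeval (aT F d θ θs) (tauPoly θ i)) * esT F d θ θs 0 -
    (ζ i / ∏ h ∈ Finset.Icc 1 i, (θs 0 - θs h)) • esT F d θ θs 0

/-- The left ideal `J = T(1−e*_0) + Σ_{i=1}^d T g_i` of `T`, as a submodule of `T` over
itself (with the left regular action). -/
def Jideal (F : Type*) [Field F] (d : ℕ) (θ θs : ℕ → F) (ζ : ℕ → F) :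
    Submodule (TAlg F d θ θs) (TAlg F d θ θs) :=
  Submodule.span (TAlg F d θ θs)
    ({1 - esT F d θ θs 0} ∪ (gElt F d θ θs ζ '' Set.Icc 1 d))

/-- The `F`-subspace `D D* D D* D ⋯ D D* D` of `T` with `n+1` factors `D`. -/
def DDchain (F : Type*) [Field F] (d : ℕ) (θ θs : ℕ → F) : ℕ → Submodule F (TAlg F d θ θs)
  | 0 => Dsub F d θ θs
  | n + 1 => DDchain F d θ θs n * DsSub F d θ θs * Dsub F d θ θs

/-- The `F`-subspace `e*_r D e*_{κ 1} D e*_{κ 2} ⋯ D e*_{κ m}` of `T`. -/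
def esChain (F : Type*) [Field F] (d : ℕ) (θ θs : ℕ → F) (r : ℕ) (κ : ℕ → ℕ) :
    ℕ → Submodule F (TAlg F d θ θs)
  | 0 => Submodule.span F {esT F d θ θs r}
  | m + 1 => esChain F d θ θs r κ m * Dsub F d θ θs *
      Submodule.span F {esT F d θ θs (κ (m + 1))}

/-- The sequence `(c_0, c_1, …, c_m)` is convex: `c_{i−1} − c_i ≥ c_i − c_{i+1}`
for `1 ≤ i ≤ m−1`. -/
def ConvexSeq (c : ℕ → ℤ) (m : ℕ) : Prop :=
  ∀ i, 1 ≤ i → i + 1 ≤ m → c i - c (i + 1) ≤ c (i - 1) - c i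

end

/-- If `a = ∑ θ_i e_i` for complete orthogonal idempotents `e_i` and mutually distinct scalars
`θ_i`, then each `e_i` is a polynomial in `a`. -/
theorem idempotent_mem_adjoin {F R ι : Type*} [Field F] [Ring R] [Algebra F R] [Fintype ι]
    [DecidableEq ι] {e : ι → R} {θ : ι → F} {a : R}
    (he : ∀ i j, e i * e j = if i = j then e i else 0) (hsum : ∑ i, e i = 1)
    (hθ : Function.Injective θ) (ha : a = ∑ i, θ i • e i) (i : ι) :
    e i ∈ Algebra.adjoin F {a} := by
  have hae : ∀ j, a * e j = θ j • e j := fun j => by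
    simp [ha, Finset.sum_mul, he]
  have hp : ∀ (p : F[X]) (j : ι), aeval a p * e j = p.eval (θ j) • e j := by
    intro p j
    induction p using Polynomial.induction_on' with
    | add p q hp hq => simp [add_mul, add_smul, hp, hq]
    | monomial n c =>
      have hpow : a ^ n * e j = θ j ^ n • e j := by
        induction n with
        | zero => simp
        | succ n ih => rw [pow_succ, mul_assoc, hae, mul_smul_comm, ih, smul_smul, pow_succ']
      rw [aeval_monomial, eval_monomial, mul_assoc, hpow, ← Algebra.smul_def, smul_smul]
  have key : aeval a (Lagrange.basis Finset.univ θ i) = e i := by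
    rw [← mul_one (aeval a _), ← hsum, Finset.mul_sum, Finset.sum_eq_single i]
    · rw [hp, Lagrange.eval_basis_self hθ.injOn (Finset.mem_univ i), one_smul]
    · intro j _ hj
      rw [hp, Lagrange.eval_basis_of_ne hj.symm (Finset.mem_univ j), zero_smul]
    · simp
  rw [← key]
  exact aeval_mem_adjoin_singleton F a

/-- Let `R` be generated by `a` and complete orthogonal idempotents `f_0, …, f_d` with respect to
which `a` is block tridiagonal. If `V` is a simple `R`-module, then the indices `i` such that
`f_i V ≠ 0` form an interval. -/
theorem exists_interval_of_tridiagonal {F R V : Type*} [Field F] [Ring R] [Algebra F R]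
    [AddCommGroup V] [Module F V] [Module R V] [IsScalarTower F R V] [IsSimpleModule R V]
    {d : ℕ} {f : Fin (d + 1) → R} {a : R}
    (hf : ∀ i j, f i * f j = if i = j then f i else 0) (hsum : ∑ i, f i = 1)
    (htri : ∀ i j : Fin (d + 1), (j : ℕ) + 1 < i → f i * a * f j = 0)
    (hgen : Algebra.adjoin F (insert a (Set.range f)) = ⊤) :
    ∃ r δ : ℕ, r + δ ≤ d ∧ ∀ i : Fin (d + 1),
      ((∃ v : V, f i • v ≠ 0) ↔ (r ≤ i ∧ i ≤ r + δ)) := by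
  have convex : ∀ i j k : Fin (d + 1), i < j → j < k → (∃ v : V, f i • v ≠ 0) →
      (∃ v : V, f k • v ≠ 0) → ∃ v : V, f j • v ≠ 0 := by
    rintro i j k hij hjk ⟨v, hv⟩ ⟨u, hu⟩
    by_contra! hj
    have inv : ∀ x : R, ∀ w : V, (∀ m, j ≤ m → f m • w = 0) →
        ∀ m, j ≤ m → f m • x • w = 0 := by
      intro x
      have hx : x ∈ Algebra.adjoin F (insert a (Set.range f)) := hgen ▸ Algebra.mem_top
      induction hx using Algebra.adjoin_induction with
      | mem x hx =>
        intro w hw m hm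
        rcases hx with rfl | ⟨l, rfl⟩
        · rcases hm.eq_or_lt with rfl | hm
          · exact hj _
          · rw [← one_smul R w, ← hsum, Finset.sum_smul, Finset.smul_sum, Finset.smul_sum]
            refine Finset.sum_eq_zero fun l _ => ?_
            by_cases hl : j ≤ l
            · simp [hw l hl]
            · rw [← mul_smul, ← mul_smul, htri m l (by omega), zero_smul]
        · rw [← mul_smul, hf]
          split_ifs
          · exact hw m hm
          · exact zero_smul R w
      | algebraMap c =>
        intro w hw m hm
        rw [← mul_smul, ← Algebra.commutes, mul_smul, hw m hm, smul_zero]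
      | add x y _ _ hx hy =>
        intro w hw m hm
        rw [add_smul, smul_add, hx w hw m hm, hy w hw m hm, add_zero]
      | mul x y _ _ hx hy =>
        intro w hw m hm
        rw [mul_smul]
        exact hx _ (hy w hw) m hm
    let W : Submodule R V :=
      { carrier := {w | ∀ m, j ≤ m → f m • w = 0}
        zero_mem' := fun m _ => smul_zero _
        add_mem' := fun hx hy m hm => by rw [smul_add, hx m hm, hy m hm, add_zero]
        smul_mem' := fun x w hw => inv x w hw }
    have hiW : f i • v ∈ W := fun m hm => by
      rw [← mul_smul, hf, if_neg (by omega), zero_smul]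
    rcases eq_bot_or_eq_top W with hW | hW
    · exact hv (by simpa [hW] using hiW)
    · have huW : u ∈ W := hW ▸ Submodule.mem_top
      exact hu (huW k hjk.le)
  classical
  let S : Finset (Fin (d + 1)) := Finset.univ.filter fun i => ∃ v : V, f i • v ≠ 0
  have hS : S.Nonempty := by
    by_contra hS
    have := IsSimpleModule.nontrivial R V
    obtain ⟨v, hv⟩ := exists_ne (0 : V)
    refine hv ?_
    rw [← one_smul R v, ← hsum, Finset.sum_smul]
    refine Finset.sum_eq_zero fun i _ => ?_
    by_contra hi
    exact hS ⟨i, Finset.mem_filter.2 ⟨Finset.mem_univ i, v, hi⟩⟩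
  have hmin := (Finset.mem_filter.1 (S.min'_mem hS)).2
  have hmax := (Finset.mem_filter.1 (S.max'_mem hS)).2
  have hle : S.min' hS ≤ S.max' hS := S.min'_le _ (S.max'_mem hS)
  refine ⟨S.min' hS, S.max' hS - S.min' hS, by omega, fun i => ⟨fun hi => ?_, fun hi => ?_⟩⟩
  · have hiS : i ∈ S := Finset.mem_filter.2 ⟨Finset.mem_univ i, hi⟩
    have h1 := S.min'_le i hiS
    have h2 := S.le_max' i hiS
    omega
  · rcases (show S.min' hS ≤ i by omega).eq_or_lt with h1 | h1
    · rwa [← h1]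
    rcases (show i ≤ S.max' hS by omega).eq_or_lt with h2 | h2
    · rwa [h2]
    exact convex _ i _ h1 h2 hmin hmax

section TAlgRelations

variable {F : Type*} [Field F] {d : ℕ} {θ θs : ℕ → F}

theorem TRel.mkAlgHom_eq {x y : FreeAlgebra F (TGen d)} (h : TRel F d θ θs x y) :
    RingQuot.mkAlgHom F (TRel F d θ θs) x = RingQuot.mkAlgHom F (TRel F d θ θs) y :=
  RingQuot.mkAlgHom_rel F h

theorem tgen_e_mul (i j : Fin (d + 1)) :
    tgen F d θ θs (.e i) * tgen F d θ θs (.e j) = if i = j then tgen F d θ θs (.e i) else 0 := by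
  simpa [apply_ite, tgen] using (TRel.ee (θ := θ) (θs := θs) i j).mkAlgHom_eq

theorem tgen_estar_mul (i j : Fin (d + 1)) :
    tgen F d θ θs (.estar i) * tgen F d θ θs (.estar j) =
      if i = j then tgen F d θ θs (.estar i) else 0 := by
  simpa [apply_ite, tgen] using (TRel.eses (θ := θ) (θs := θs) i j).mkAlgHom_eq

theorem sum_tgen_e : ∑ i, tgen F d θ θs (.e i) = 1 := by
  simpa [tgen] using (TRel.sum_e (θ := θ) (θs := θs)).mkAlgHom_eq

theorem sum_tgen_estar : ∑ i, tgen F d θ θs (.estar i) = 1 := by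
  simpa [tgen] using (TRel.sum_estar (θ := θ) (θs := θs)).mkAlgHom_eq

theorem tgen_a_eq : tgen F d θ θs .a = ∑ i : Fin (d + 1), θ i • tgen F d θ θs (.e i) := by
  simpa [tgen] using (TRel.a_eq (θ := θ) (θs := θs)).mkAlgHom_eq

theorem tgen_astar_eq :
    tgen F d θ θs .astar = ∑ i : Fin (d + 1), θs i • tgen F d θ θs (.estar i) := by
  simpa [tgen] using (TRel.astar_eq (θ := θ) (θs := θs)).mkAlgHom_eq

theorem tgen_estar_mul_a_mul_estar {i j : Fin (d + 1)} (h : (j : ℕ) + 1 < i) :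
    tgen F d θ θs (.estar i) * tgen F d θ θs .a * tgen F d θ θs (.estar j) = 0 := by
  simpa [tgen] using
    (TRel.trid (θ := θ) (θs := θs) i j 1 (by omega) (by omega)).mkAlgHom_eq

theorem tgen_e_mul_astar_mul_e {i j : Fin (d + 1)} (h : (j : ℕ) + 1 < i) :
    tgen F d θ θs (.e i) * tgen F d θ θs .astar * tgen F d θ θs (.e j) = 0 := by
  simpa [tgen] using
    (TRel.tridstar (θ := θ) (θs := θs) i j 1 (by omega) (by omega)).mkAlgHom_eq

theorem eq_top_of_forall_tgen_mem {S : Subalgebra F (TAlg F d θ θs)}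
    (hS : ∀ g, tgen F d θ θs g ∈ S) : S = ⊤ := by
  have hrange : (RingQuot.mkAlgHom F (TRel F d θ θs)).range = ⊤ :=
    AlgHom.range_eq_top _ |>.2 (RingQuot.mkAlgHom_surjective F _)
  rw [eq_top_iff, ← hrange, ← Algebra.map_top, ← FreeAlgebra.adjoin_range_ι,
    AlgHom.map_adjoin, Algebra.adjoin_le_iff]
  rintro _ ⟨_, ⟨g, rfl⟩, rfl⟩
  exact hS g

theorem adjoin_a_estar (hθ : Function.Injective fun i : Fin (d + 1) => θ i) :
    Algebra.adjoin F (insert (tgen F d θ θs .a)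
      (Set.range fun i => tgen F d θ θs (.estar i))) = ⊤ := by
  have hestar : ∀ i, tgen F d θ θs (.estar i) ∈ Algebra.adjoin F (insert (tgen F d θ θs .a)
      (Set.range fun i => tgen F d θ θs (.estar i))) := fun i =>
    Algebra.subset_adjoin (Or.inr ⟨i, rfl⟩)
  refine eq_top_of_forall_tgen_mem fun g => ?_
  cases g with
  | a => exact Algebra.subset_adjoin (Set.mem_insert _ _)
  | astar =>
    rw [tgen_astar_eq]
    exact Subalgebra.sum_mem _ fun i _ => Subalgebra.smul_mem _ (hestar i) _
  | e i =>
    exact Algebra.adjoin_mono (Set.singleton_subset_iff.2 (Set.mem_insert _ _))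
      (idempotent_mem_adjoin tgen_e_mul sum_tgen_e hθ tgen_a_eq i)
  | estar i => exact hestar i

theorem adjoin_astar_e (hθs : Function.Injective fun i : Fin (d + 1) => θs i) :
    Algebra.adjoin F (insert (tgen F d θ θs .astar)
      (Set.range fun i => tgen F d θ θs (.e i))) = ⊤ := by
  have he : ∀ i, tgen F d θ θs (.e i) ∈ Algebra.adjoin F (insert (tgen F d θ θs .astar)
      (Set.range fun i => tgen F d θ θs (.e i))) := fun i =>
    Algebra.subset_adjoin (Or.inr ⟨i, rfl⟩)
  refine eq_top_of_forall_tgen_mem fun g => ?_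
  cases g with
  | astar => exact Algebra.subset_adjoin (Set.mem_insert _ _)
  | a =>
    rw [tgen_a_eq]
    exact Subalgebra.sum_mem _ fun i _ => Subalgebra.smul_mem _ (he i) _
  | estar i =>
    exact Algebra.adjoin_mono (Set.singleton_subset_iff.2 (Set.mem_insert _ _))
      (idempotent_mem_adjoin tgen_estar_mul sum_tgen_estar hθs tgen_astar_eq i)
  | e i => exact he i

end TAlgRelations

/-- For a finite-dimensional irreducible `T`-module `V`: the set of `i` with `e*_i V ≠ 0`
is an interval `[r, r+δ] ⊆ [0, d]`, and the set of `i` with `e_i V ≠ 0` is an interval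
`[t, t+δ*] ⊆ [0, d]`. -/
theorem stmt2 {F : Type*} [Field F] (d : ℕ) (θ θs : ℕ → F) (h : EigCond F d θ θs)
    (V : Type*) [AddCommGroup V] [Module F V] [Module (TAlg F d θ θs) V]
    [IsScalarTower F (TAlg F d θ θs) V] [FiniteDimensional F V]
    (hirr : IsSimpleModule (TAlg F d θ θs) V) :
    (∃ r δ : ℕ, r + δ ≤ d ∧ ∀ i, i ≤ d →
      ((∃ v : V, esT F d θ θs i • v ≠ 0) ↔ (r ≤ i ∧ i ≤ r + δ))) ∧
    (∃ t δs : ℕ, t + δs ≤ d ∧ ∀ i, i ≤ d →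
      ((∃ v : V, eT F d θ θs i • v ≠ 0) ↔ (t ≤ i ∧ i ≤ t + δs))) := by
  have hθ : Function.Injective fun i : Fin (d + 1) => θ i := fun i j hij => by
    by_contra hne
    exact h.1 i j (by omega) (by omega) (by omega) hij
  have hθs : Function.Injective fun i : Fin (d + 1) => θs i := fun i j hij => by
    by_contra hne
    exact h.2.1 i j (by omega) (by omega) (by omega) hij
  constructor
  · obtain ⟨r, δ, hle, hi⟩ := exists_interval_of_tridiagonal (V := V) tgen_estar_mul sum_tgen_estar
      (fun _ _ => tgen_estar_mul_a_mul_estar) (adjoin_a_estar (θs := θs) hθ)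
    refine ⟨r, δ, hle, fun i hid => ?_⟩
    rw [esT, dif_pos (by omega)]
    exact hi ⟨i, by omega⟩
  · obtain ⟨t, δs, hle, hi⟩ := exists_interval_of_tridiagonal (V := V) tgen_e_mul sum_tgen_e
      (fun _ _ => tgen_e_mul_astar_mul_e) (adjoin_astar_e (θ := θ) hθs)
    refine ⟨t, δs, hle, fun i hid => ?_⟩
    rw [eT, dif_pos (by omega)]
    exact hi ⟨i, by omega⟩
end

section
/- Let V denote a finite-dimensional irreducible T-module, and let r, δ (resp. t, δ*) be the nonnegative integers with r+δ ≤ d (resp. t+δ* ≤ d) such that e*_i V ≠ 0 if and only if r ≤ i ≤ r+δ (resp. e_i V ≠ 0 if and only if t ≤ i ≤ t+δ*). Then δ = δ*, and the sequence (a; {e_i}_{i=t}^{t+δ}; a*; {e*_i}_{i=r}^{r+δ}) acts on V as a tridiagonal system. -/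
open Polynomial

section TridiagonalSystems

variable {F : Type*} [Field F] {V : Type*} [AddCommGroup V] [Module F V]

/-- `A` is diagonalizable with distinct eigenvalues `θ_i` and projections `E_i` onto its
eigenspaces, where `t ≤ i ≤ t + δ`, and `E_i = 0` for all other `i`. -/
structure IsEigenSystem (A : Module.End F V) (E : ℕ → Module.End F V) (θ : ℕ → F)
    (t δ : ℕ) : Prop where
  ne_zero_iff : ∀ i, E i ≠ 0 ↔ t ≤ i ∧ i ≤ t + δ
  mul : ∀ i j, E i * E j = if i = j then E i else 0
  sum : ∑ i ∈ Finset.range (δ + 1), E (t + i) = 1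
  eq_sum : A = ∑ i ∈ Finset.range (δ + 1), θ (t + i) • E (t + i)
  injOn : ∀ i j, i ≤ δ → j ≤ δ → i ≠ j → θ (t + i) ≠ θ (t + j)

/-- `B` acts on the images of the projections `E_i` in a tridiagonal fashion. -/
def IsTridiagonal (B : Module.End F V) (E : ℕ → Module.End F V) : Prop :=
  ∀ i j, i + 1 < j ∨ j + 1 < i → ∀ v, E i (B (E j v)) = 0

namespace IsEigenSystem

variable {A : Module.End F V} {E : ℕ → Module.End F V} {θ : ℕ → F} {t δ : ℕ}

lemma apply_apply (h : IsEigenSystem A E θ t δ) (i j : ℕ) (v : V) :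
    E i (E j v) = if i = j then E i v else 0 := by
  rw [← Module.End.mul_apply, h.mul]
  split_ifs <;> simp

lemma sum_apply (h : IsEigenSystem A E θ t δ) (v : V) :
    ∑ i ∈ Finset.range (δ + 1), E (t + i) v = v := by
  simpa using LinearMap.congr_fun h.sum v

lemma eq_zero (h : IsEigenSystem A E θ t δ) {i : ℕ} (hi : ¬ (t ≤ i ∧ i ≤ t + δ)) :
    E i = 0 := by
  by_contra hne
  exact hi ((h.ne_zero_iff i).1 hne)

lemma apply_map (h : IsEigenSystem A E θ t δ) (i : ℕ) (v : V) :
    E i (A v) = θ i • E i v := by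
  by_cases hi : t ≤ i ∧ i ≤ t + δ
  · obtain ⟨⟨k, rfl⟩, hk⟩ := And.imp_left Nat.exists_eq_add_of_le hi
    have hmem : k ∈ Finset.range (δ + 1) := by simp; omega
    conv_lhs => rw [h.eq_sum]
    simp only [LinearMap.sum_apply, LinearMap.smul_apply, map_sum, map_smul, h.apply_apply]
    rw [Finset.sum_eq_single_of_mem k hmem]
    · simp
    · intro b _ hb
      simp [hb.symm]
  · simp [h.eq_zero hi]

lemma eq_zero_of_forall (h : IsEigenSystem A E θ t δ) {v : V} (hv : ∀ i, E i v = 0) :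
    v = 0 := by
  rw [← h.sum_apply v]
  exact Finset.sum_eq_zero fun i _ => hv _

lemma ext_apply (h : IsEigenSystem A E θ t δ) {v w : V} (hv : ∀ i, E i v = E i w) :
    v = w :=
  sub_eq_zero.1 (h.eq_zero_of_forall fun i => by rw [map_sub, hv, sub_self])

lemma apply_aeval (h : IsEigenSystem A E θ t δ) (p : F[X]) (i : ℕ) (v : V) :
    E i (aeval A p v) = p.eval (θ i) • E i v := by
  induction p using Polynomial.induction_on' with
  | add p q hp hq => simp [hp, hq, add_smul]
  | monomial n c =>
    have hpow : E i ((A ^ n) v) = θ i ^ n • E i v := by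
      induction n with
      | zero => simp
      | succ n ih => rw [pow_succ', Module.End.mul_apply, h.apply_map, ih, smul_smul, pow_succ']
    simp [aeval_monomial, hpow, smul_smul, Module.algebraMap_end_apply]

/-- The projections onto the eigenspaces of `A` are polynomials in `A`. -/
lemma exists_aeval (h : IsEigenSystem A E θ t δ) (i : ℕ) : ∃ p : F[X], aeval A p = E i := by
  by_cases hi : t ≤ i ∧ i ≤ t + δ
  · refine ⟨Lagrange.basis (Finset.Icc t (t + δ)) θ i, LinearMap.ext fun v =>
      h.ext_apply fun k => ?_⟩
    rw [h.apply_aeval, h.apply_apply]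
    by_cases hk : t ≤ k ∧ k ≤ t + δ
    · split_ifs with hki
      · subst hki
        rw [Lagrange.eval_basis_self _ (Finset.mem_Icc.2 hk), one_smul]
        intro x hx y hy hxy
        simp only [Finset.coe_Icc, Set.mem_Icc] at hx hy
        obtain ⟨⟨x, rfl⟩, hx⟩ := And.imp_left Nat.exists_eq_add_of_le hx
        obtain ⟨⟨y, rfl⟩, hy⟩ := And.imp_left Nat.exists_eq_add_of_le hy
        by_contra hne
        exact h.injOn x y (by omega) (by omega) (by omega) hxy
      · rw [Lagrange.eval_basis_of_ne (Ne.symm hki) (Finset.mem_Icc.2 hk), zero_smul]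
    · simp [h.eq_zero hk]
  · exact ⟨0, by simp [h.eq_zero hi]⟩

lemma apply_mem (h : IsEigenSystem A E θ t δ) {W : Submodule F V} (hW : ∀ w ∈ W, A w ∈ W)
    (i : ℕ) {w : V} (hw : w ∈ W) : E i w ∈ W := by
  obtain ⟨p, hp⟩ := h.exists_aeval i
  rw [← hp]
  have hpow : ∀ n : ℕ, (A ^ n) w ∈ W := fun n => by
    induction n with
    | zero => simpa
    | succ n ih => rw [pow_succ', Module.End.mul_apply]; exact hW _ ih
  rw [aeval_eq_sum_range]
  simp only [LinearMap.sum_apply, LinearMap.smul_apply]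
  exact W.sum_mem fun n _ => W.smul_mem _ (hpow n)

/-- If `v` is supported on a set `S` of indices, then `B v` has no component at an index
far from `S`. -/
lemma apply_tridiagonal_eq_zero (h : IsEigenSystem A E θ t δ) {B : Module.End F V}
    (hB : IsTridiagonal B E) {k : ℕ} {v : V}
    (hv : ∀ l, E l v ≠ 0 → k + 1 < l ∨ l + 1 < k) : E k (B v) = 0 := by
  conv_lhs => rw [← h.sum_apply v]
  simp only [map_sum]
  refine Finset.sum_eq_zero fun l _ => ?_
  by_cases hl : E (t + l) v = 0
  · simp [hl]
  · exact hB _ _ (hv _ hl) v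

lemma map_range_le (h : IsEigenSystem A E θ t δ) {B : Module.End F V}
    (hB : IsTridiagonal B E) {i : ℕ} (hi : i ≤ δ) :
    Submodule.map B (LinearMap.range (E (t + i))) ≤
      (if i = 0 then ⊥ else LinearMap.range (E (t + (i - 1)))) ⊔ LinearMap.range (E (t + i)) ⊔
        (if i = δ then ⊥ else LinearMap.range (E (t + (i + 1)))) := by
  rintro _ ⟨_, ⟨v, rfl⟩, rfl⟩
  rw [← h.sum_apply (B (E (t + i) v))]
  refine Submodule.sum_mem _ fun k hk => ?_
  rw [Finset.mem_range] at hk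
  by_cases h1 : k = i
  · subst h1
    exact Submodule.mem_sup_left (Submodule.mem_sup_right (LinearMap.mem_range_self _ _))
  by_cases h2 : k + 1 = i
  · refine Submodule.mem_sup_left (Submodule.mem_sup_left ?_)
    subst h2
    simp
  by_cases h3 : k = i + 1
  · refine Submodule.mem_sup_right ?_
    rw [if_neg (by omega), h3]
    exact LinearMap.mem_range_self _ _
  · rw [hB _ _ (by omega)]
    exact Submodule.zero_mem _

variable {B : Module.End F V} {Es : ℕ → Module.End F V} {θs : ℕ → F} {r δs : ℕ}

/-- The intersection `(V*_0 + ⋯ + V*_i) ∩ (V_j + ⋯ + V_d)`, in terms of the projections `Es`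
onto the `V*_k` and the projections `E` onto the `V_k`. -/
def splitSubmodule (Es E : ℕ → Module.End F V) (i j : ℕ) : Submodule F V :=
  (⨅ k, ⨅ _ : i < k, LinearMap.ker (Es k)) ⊓ ⨅ k, ⨅ _ : k < j, LinearMap.ker (E k)

lemma mem_splitSubmodule {i j : ℕ} {v : V} :
    v ∈ splitSubmodule Es E i j ↔ (∀ k, i < k → Es k v = 0) ∧ ∀ k, k < j → E k v = 0 := by
  simp [splitSubmodule]

lemma map_sub_mem_splitSubmodule (h : IsEigenSystem A E θ t δ)
    (hs : IsEigenSystem B Es θs r δs) (hA : IsTridiagonal A Es) {i j : ℕ} {v : V}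
    (hv : v ∈ splitSubmodule Es E i j) :
    A v - θ j • v ∈ splitSubmodule Es E (i + 1) (j + 1) := by
  rw [mem_splitSubmodule] at hv ⊢
  refine ⟨fun k hk => ?_, fun k hk => ?_⟩
  · rw [map_sub, map_smul, hv.1 k (by omega), hs.apply_tridiagonal_eq_zero hA]
    · simp
    · intro l hl
      by_contra hcon
      exact hl (hv.1 l (by omega))
  · rw [map_sub, map_smul, h.apply_map]
    rcases Nat.lt_succ_iff_lt_or_eq.1 hk with hk | rfl
    · simp [hv.2 k hk]
    · simp

lemma dual_map_sub_mem_splitSubmodule (h : IsEigenSystem A E θ t δ)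
    (hs : IsEigenSystem B Es θs r δs) (hB : IsTridiagonal B E) {i j : ℕ} {v : V}
    (hv : v ∈ splitSubmodule Es E (i + 1) (j + 1)) :
    B v - θs (i + 1) • v ∈ splitSubmodule Es E i j := by
  rw [mem_splitSubmodule] at hv ⊢
  refine ⟨fun k hk => ?_, fun k hk => ?_⟩
  · rw [map_sub, map_smul, hs.apply_map]
    rcases Nat.eq_or_lt_of_le (Nat.succ_le_of_lt hk) with rfl | hk
    · simp
    · simp [hv.1 k hk]
  · rw [map_sub, map_smul, hv.2 k (by omega), h.apply_tridiagonal_eq_zero hB]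
    · simp
    · intro l hl
      by_contra hcon
      exact hl (hv.2 l (by omega))

lemma dual_map_sub_eq_zero (hs : IsEigenSystem B Es θs r δs) {j : ℕ} {v : V}
    (hv : v ∈ splitSubmodule Es E r j) : B v - θs r • v = 0 := by
  rw [mem_splitSubmodule] at hv
  refine hs.eq_zero_of_forall fun k => ?_
  rw [map_sub, map_smul, hs.apply_map]
  rcases lt_trichotomy k r with hk | rfl | hk
  · simp [hs.eq_zero (i := k) (by omega)]
  · simp
  · simp [hv.1 k hk]

/-- In an irreducible situation, `A` has at most as many eigenspaces as `B`. -/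
lemma diameter_le (h : IsEigenSystem A E θ t δ) (hs : IsEigenSystem B Es θs r δs)
    (hA : IsTridiagonal A Es) (hB : IsTridiagonal B E)
    (hirr : ∀ W : Submodule F V, (∀ w ∈ W, A w ∈ W) → (∀ w ∈ W, B w ∈ W) → W = ⊥ ∨ W = ⊤) :
    δ ≤ δs := by
  by_contra! hlt
  obtain ⟨m, rfl⟩ := Nat.exists_eq_add_of_lt hlt
  set U : ℕ → Submodule F V := fun i => splitSubmodule Es E (r + i) (t + m + 1 + i)
  have hAU : ∀ w ∈ ⨆ i, U i, A w ∈ ⨆ i, U i := by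
    intro w hw
    suffices hle : ⨆ i, U i ≤ (⨆ i, U i).comap A from hle hw
    refine iSup_le fun i v hv => ?_
    have h1 := Submodule.mem_iSup_of_mem (p := U) (i + 1)
      (h.map_sub_mem_splitSubmodule hs hA hv)
    have h2 := Submodule.smul_mem _ (θ (t + m + 1 + i)) (Submodule.mem_iSup_of_mem (p := U) i hv)
    simpa using Submodule.add_mem _ h1 h2
  have hBU : ∀ w ∈ ⨆ i, U i, B w ∈ ⨆ i, U i := by
    intro w hw
    suffices hle : ⨆ i, U i ≤ (⨆ i, U i).comap B from hle hw
    refine iSup_le fun i v hv => ?_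
    have h2 := Submodule.smul_mem _ (θs (r + i)) (Submodule.mem_iSup_of_mem (p := U) i hv)
    have h1 : B v - θs (r + i) • v ∈ ⨆ i, U i := by
      cases i with
      | zero =>
        rw [Nat.add_zero, hs.dual_map_sub_eq_zero hv]
        exact Submodule.zero_mem _
      | succ i =>
        exact Submodule.mem_iSup_of_mem (p := U) i
          (h.dual_map_sub_mem_splitSubmodule hs hB hv)
    simpa using Submodule.add_mem _ h1 h2
  rcases hirr _ hAU hBU with hbot | htop
  · refine (h.ne_zero_iff (t + (δs + m + 1))).2 (by omega) (LinearMap.ext fun v => ?_)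
    have hmem : E (t + (δs + m + 1)) v ∈ U δs := by
      refine mem_splitSubmodule.2 ⟨fun k hk => ?_, fun k hk => ?_⟩
      · simp [hs.eq_zero (i := k) (by omega)]
      · rw [h.apply_apply, if_neg (by omega)]
    have := Submodule.mem_iSup_of_mem (p := U) δs hmem
    rwa [hbot, Submodule.mem_bot] at this
  · refine (h.ne_zero_iff t).2 (by omega) (LinearMap.ext fun v => ?_)
    have hle : ⨆ i, U i ≤ LinearMap.ker (E t) :=
      iSup_le fun i v hv => (mem_splitSubmodule.1 hv).2 t (by omega)
    exact hle (htop ▸ Submodule.mem_top)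

/-- A compatible pair of eigensystems acting irreducibly is a tridiagonal system. -/
lemma isTDSystem [FiniteDimensional F V] [Nontrivial V] (h : IsEigenSystem A E θ t δ)
    (hs : IsEigenSystem B Es θs r δ) (hA : IsTridiagonal A Es) (hB : IsTridiagonal B E)
    (hirr : ∀ W : Submodule F V, (∀ w ∈ W, A w ∈ W) → (∀ w ∈ W, B w ∈ W) → W = ⊥ ∨ W = ⊤) :
    IsTDSystem F V δ A B (fun i => E (t + i)) (fun i => Es (r + i))
      (fun i => θ (t + i)) (fun i => θs (r + i)) := by
  refine ⟨inferInstance, Module.finrank_pos, h.injOn, hs.injOn,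
    fun i hi => (h.ne_zero_iff _).2 (by omega), fun i hi => (hs.ne_zero_iff _).2 (by omega),
    fun i j _ _ => ?_, fun i j _ _ => ?_, h.sum, hs.sum, h.eq_sum, hs.eq_sum,
    fun i hi => h.map_range_le hB hi, fun i hi => hs.map_range_le hA hi, hirr⟩
  · simpa [Module.End.mul_eq_comp] using h.mul (t + i) (t + j)
  · simpa [Module.End.mul_eq_comp] using hs.mul (r + i) (r + j)

end IsEigenSystem

end TridiagonalSystems

section Relations

variable {F : Type*} [Field F] {d : ℕ} {θ θs : ℕ → F}

lemma eT_of_lt {i : ℕ} (hi : i < d + 1) :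
    eT F d θ θs i = tgen F d θ θs (TGen.e ⟨i, hi⟩) := by
  simp [eT, hi]

lemma esT_of_lt {i : ℕ} (hi : i < d + 1) :
    esT F d θ θs i = tgen F d θ θs (TGen.estar ⟨i, hi⟩) := by
  simp [esT, hi]

lemma eT_of_not_lt {i : ℕ} (hi : ¬ i < d + 1) : eT F d θ θs i = 0 := by
  simp [eT, hi]

lemma esT_of_not_lt {i : ℕ} (hi : ¬ i < d + 1) : esT F d θ θs i = 0 := by
  simp [esT, hi]

lemma eT_mul_eT (i j : ℕ) :
    eT F d θ θs i * eT F d θ θs j = if i = j then eT F d θ θs i else 0 := by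
  by_cases hi : i < d + 1
  · by_cases hj : j < d + 1
    · rw [eT_of_lt hi, eT_of_lt hj]
      have := RingQuot.mkAlgHom_rel F (TRel.ee (F := F) (θ := θ) (θs := θs) ⟨i, hi⟩ ⟨j, hj⟩)
      rw [map_mul, apply_ite (RingQuot.mkAlgHom F (TRel F d θ θs)), map_zero] at this
      simpa [tgen] using this
    · rw [eT_of_not_lt hj, mul_zero, if_neg (by omega)]
  · simp [eT_of_not_lt hi]

lemma esT_mul_esT (i j : ℕ) :
    esT F d θ θs i * esT F d θ θs j = if i = j then esT F d θ θs i else 0 := by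
  by_cases hi : i < d + 1
  · by_cases hj : j < d + 1
    · rw [esT_of_lt hi, esT_of_lt hj]
      have := RingQuot.mkAlgHom_rel F (TRel.eses (F := F) (θ := θ) (θs := θs) ⟨i, hi⟩ ⟨j, hj⟩)
      rw [map_mul, apply_ite (RingQuot.mkAlgHom F (TRel F d θ θs)), map_zero] at this
      simpa [tgen] using this
    · rw [esT_of_not_lt hj, mul_zero, if_neg (by omega)]
  · simp [esT_of_not_lt hi]

lemma sum_eT : ∑ i ∈ Finset.range (d + 1), eT F d θ θs i = 1 := by
  have := RingQuot.mkAlgHom_rel F (TRel.sum_e (F := F) (d := d) (θ := θ) (θs := θs))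
  rw [map_sum, map_one] at this
  rw [← this, Finset.sum_range]
  exact Finset.sum_congr rfl fun i _ => eT_of_lt i.2

lemma sum_esT : ∑ i ∈ Finset.range (d + 1), esT F d θ θs i = 1 := by
  have := RingQuot.mkAlgHom_rel F (TRel.sum_estar (F := F) (d := d) (θ := θ) (θs := θs))
  rw [map_sum, map_one] at this
  rw [← this, Finset.sum_range]
  exact Finset.sum_congr rfl fun i _ => esT_of_lt i.2

lemma aT_eq_sum : aT F d θ θs = ∑ i ∈ Finset.range (d + 1), θ i • eT F d θ θs i := by
  have := RingQuot.mkAlgHom_rel F (TRel.a_eq (F := F) (d := d) (θ := θ) (θs := θs))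
  rw [map_sum] at this
  rw [aT, tgen, this, Finset.sum_range]
  exact Finset.sum_congr rfl fun i _ => by rw [map_smul, eT_of_lt i.2]; rfl

lemma asT_eq_sum : asT F d θ θs = ∑ i ∈ Finset.range (d + 1), θs i • esT F d θ θs i := by
  have := RingQuot.mkAlgHom_rel F (TRel.astar_eq (F := F) (d := d) (θ := θ) (θs := θs))
  rw [map_sum] at this
  rw [asT, tgen, this, Finset.sum_range]
  exact Finset.sum_congr rfl fun i _ => by rw [map_smul, esT_of_lt i.2]; rfl

lemma esT_mul_aT_mul_esT {i j : ℕ} (hij : i + 1 < j ∨ j + 1 < i) :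
    esT F d θ θs i * aT F d θ θs * esT F d θ θs j = 0 := by
  by_cases hi : i < d + 1
  · by_cases hj : j < d + 1
    · have := RingQuot.mkAlgHom_rel F (TRel.trid (F := F) (θ := θ) (θs := θs) ⟨i, hi⟩ ⟨j, hj⟩ 1
        (by omega) (by simp only [lt_max_iff]; omega))
      rw [esT_of_lt hi, esT_of_lt hj]
      simpa [tgen, aT] using this
    · simp [esT_of_not_lt hj]
  · simp [esT_of_not_lt hi]

lemma eT_mul_asT_mul_eT {i j : ℕ} (hij : i + 1 < j ∨ j + 1 < i) :
    eT F d θ θs i * asT F d θ θs * eT F d θ θs j = 0 := by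
  by_cases hi : i < d + 1
  · by_cases hj : j < d + 1
    · have := RingQuot.mkAlgHom_rel F (TRel.tridstar (F := F) (θ := θ) (θs := θs)
        ⟨i, hi⟩ ⟨j, hj⟩ 1 (by omega) (by simp only [lt_max_iff]; omega))
      rw [eT_of_lt hi, eT_of_lt hj]
      simpa [tgen, asT] using this
    · simp [eT_of_not_lt hj]
  · simp [eT_of_not_lt hi]

/-- Reindexing a sum over `0, …, d` whose terms vanish outside `t, …, t + δ`. -/
lemma sum_range_eq_sum_shift {M : Type*} [AddCommMonoid M] {f : ℕ → M} {t δ : ℕ}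
    (htd : t + δ ≤ d) (hf : ∀ i, ¬ (t ≤ i ∧ i ≤ t + δ) → f i = 0) :
    ∑ i ∈ Finset.range (d + 1), f i = ∑ i ∈ Finset.range (δ + 1), f (t + i) := by
  rw [show ∑ i ∈ Finset.range (δ + 1), f (t + i) = ∑ i ∈ Finset.Ico t (t + δ + 1), f i by
    rw [Finset.sum_Ico_eq_sum_range]; congr 2; omega]
  refine (Finset.sum_subset (fun i hi => ?_) fun i _ hi => hf i ?_).symm
  · simp only [Finset.mem_Ico, Finset.mem_range] at hi ⊢
    omega
  · simp only [Finset.mem_Ico] at hi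
    omega

variable {V : Type*} [AddCommGroup V] [Module F V] [Module (TAlg F d θ θs) V]
  [IsScalarTower F (TAlg F d θ θs) V]

/-- An orthogonal resolution of the identity in `T` acts on a module as an eigensystem. -/
lemma isEigenSystem_actL {x : TAlg F d θ θs} {e : ℕ → TAlg F d θ θs} {φ : ℕ → F} {t δ : ℕ}
    (htd : t + δ ≤ d) (hφ : ∀ i j, i ≤ d → j ≤ d → i ≠ j → φ i ≠ φ j)
    (he : ∀ i, ¬ i < d + 1 → e i = 0) (hmul : ∀ i j, e i * e j = if i = j then e i else 0)
    (hsum : ∑ i ∈ Finset.range (d + 1), e i = 1)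
    (hx : x = ∑ i ∈ Finset.range (d + 1), φ i • e i)
    (hne : ∀ i, i ≤ d → ((∃ v : V, e i • v ≠ 0) ↔ (t ≤ i ∧ i ≤ t + δ))) :
    IsEigenSystem (actL (M := V) x) (fun i => actL (M := V) (e i)) φ t δ := by
  let ρ : TAlg F d θ θs →ₐ[F] Module.End F V := Algebra.lsmul F F V
  have hne' : ∀ i, ρ (e i) ≠ 0 ↔ t ≤ i ∧ i ≤ t + δ := by
    intro i
    by_cases hi : i < d + 1
    · rw [← hne i (by omega), Ne, LinearMap.ext_iff, not_forall]
      rfl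
    · rw [he i hi, map_zero]
      exact ⟨fun hcon => absurd rfl hcon, fun hcon => by omega⟩
  have hzero : ∀ i, ¬ (t ≤ i ∧ i ≤ t + δ) → ρ (e i) = 0 := by
    intro i hi
    by_contra hcon
    exact hi ((hne' i).1 hcon)
  refine ⟨hne', fun i j => ?_, ?_, ?_, fun i j hi hj hij => hφ _ _ (by omega) (by omega) (by omega)⟩
  · change ρ (e i) * ρ (e j) = if i = j then ρ (e i) else 0
    rw [← map_mul, hmul, apply_ite ρ, map_zero]
  · change ∑ i ∈ Finset.range (δ + 1), ρ (e (t + i)) = 1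
    rw [← sum_range_eq_sum_shift htd hzero, ← map_sum, hsum, map_one]
  · change ρ x = ∑ i ∈ Finset.range (δ + 1), φ (t + i) • ρ (e (t + i))
    rw [← sum_range_eq_sum_shift (f := fun i => φ i • ρ (e i)) htd
      fun i hi => by simp [hzero i hi], hx, map_sum]
    simp only [map_smul]

/-- A subspace invariant under the generators of `T` is invariant under `T`. -/
lemma smul_mem_of_generators {W : Submodule F V}
    (hW : ∀ g, ∀ w ∈ W, tgen F d θ θs g • w ∈ W) (x : TAlg F d θ θs) :
    ∀ w ∈ W, x • w ∈ W := by
  obtain ⟨y, rfl⟩ := RingQuot.mkAlgHom_surjective F (TRel F d θ θs) x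
  induction y using FreeAlgebra.induction with
  | grade0 c =>
    intro w hw
    rw [AlgHom.commutes, algebraMap_smul]
    exact W.smul_mem c hw
  | grade1 g => exact hW g
  | mul y z hy hz =>
    intro w hw
    rw [map_mul, mul_smul]
    exact hy _ (hz _ hw)
  | add y z hy hz =>
    intro w hw
    rw [map_add, add_smul]
    exact W.add_mem (hy _ hw) (hz _ hw)

end Relations

/-- For a finite-dimensional irreducible `T`-module `V` with parameters `r, δ, t, δ*` as in
Lemma `basic3`, one has `δ = δ*` and `(a; {e_i}_{i=t}^{t+δ}; a*; {e*_i}_{i=r}^{r+δ})` acts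
on `V` as a tridiagonal system. -/
theorem stmt3 {F : Type*} [Field F] (d : ℕ) (θ θs : ℕ → F) (h : EigCond F d θ θs)
    (V : Type*) [AddCommGroup V] [Module F V] [Module (TAlg F d θ θs) V]
    [IsScalarTower F (TAlg F d θ θs) V] [FiniteDimensional F V]
    (hirr : IsSimpleModule (TAlg F d θ θs) V)
    (r δ t δs : ℕ) (hrd : r + δ ≤ d) (htd : t + δs ≤ d)
    (hEs : ∀ i, i ≤ d → ((∃ v : V, esT F d θ θs i • v ≠ 0) ↔ (r ≤ i ∧ i ≤ r + δ)))
    (hE : ∀ i, i ≤ d → ((∃ v : V, eT F d θ θs i • v ≠ 0) ↔ (t ≤ i ∧ i ≤ t + δs))) :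
    δ = δs ∧
    IsTDSystem F V δ (actL (M := V) (aT F d θ θs)) (actL (M := V) (asT F d θ θs))
      (fun i => actL (M := V) (eT F d θ θs (t + i)))
      (fun i => actL (M := V) (esT F d θ θs (r + i)))
      (fun i => θ (t + i)) (fun i => θs (r + i)) := by
  have := hirr.nontrivial
  have hA := isEigenSystem_actL (V := V) htd h.1 (fun _ => eT_of_not_lt) eT_mul_eT sum_eT
    aT_eq_sum hE
  have hB := isEigenSystem_actL (V := V) hrd h.2.1 (fun _ => esT_of_not_lt) esT_mul_esT sum_esT
    asT_eq_sum hEs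
  have hA3 : IsTridiagonal (actL (M := V) (aT F d θ θs))
      (fun i => actL (M := V) (esT F d θ θs i)) := by
    intro i j hij v
    change esT F d θ θs i • aT F d θ θs • esT F d θ θs j • v = 0
    rw [smul_smul, smul_smul, esT_mul_aT_mul_esT hij, zero_smul]
  have hB3 : IsTridiagonal (actL (M := V) (asT F d θ θs))
      (fun i => actL (M := V) (eT F d θ θs i)) := by
    intro i j hij v
    change eT F d θ θs i • asT F d θ θs • eT F d θ θs j • v = 0
    rw [smul_smul, smul_smul, eT_mul_asT_mul_eT hij, zero_smul]
  have hW : ∀ W : Submodule F V, (∀ w ∈ W, actL (M := V) (aT F d θ θs) w ∈ W) →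
      (∀ w ∈ W, actL (M := V) (asT F d θ θs) w ∈ W) → W = ⊥ ∨ W = ⊤ := by
    intro W hWa hWs
    have hgen : ∀ g, ∀ w ∈ W, tgen F d θ θs g • w ∈ W := by
      intro g w hw
      cases g with
      | a => exact hWa w hw
      | astar => exact hWs w hw
      | e i =>
        rw [← eT_of_lt i.2]
        exact hA.apply_mem hWa i hw
      | estar i =>
        rw [← esT_of_lt i.2]
        exact hB.apply_mem hWs i hw
    let W' : Submodule (TAlg F d θ θs) V :=
      { W.toAddSubmonoid with smul_mem' := fun x _ hw => smul_mem_of_generators hgen x _ hw }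
    have hmem : ∀ v, v ∈ W' ↔ v ∈ W := fun _ => Iff.rfl
    rcases eq_bot_or_eq_top W' with hbot | htop
    · left
      ext v
      rw [← hmem, hbot, Submodule.mem_bot, Submodule.mem_bot]
    · right
      ext v
      rw [← hmem, htop]
      simp
  obtain rfl : δ = δs := le_antisymm
    (hB.diameter_le hA hB3 hA3 fun W h1 h2 => hW W h2 h1) (hA.diameter_le hB hA3 hB3 hW)
  exact ⟨rfl, hA.isTDSystem hB hA3 hB3 hW⟩
end

section
/- Fix integers δ, r, t such that 0 ≤ δ ≤ d and 0 ≤ r, t ≤ d−δ. Let (A; {E_i}_{i=0}^δ; A*; {E*_i}_{i=0}^δ) denote a tridiagonal system over F on a vector space V that has eigenvalue sequence {θ_i}_{i=t}^{t+δ} and dual eigenvalue sequence {θ*_i}_{i=r}^{r+δ}. Then there exists a T-module structure on V such that: (i) a (resp. a*) acts on V as A (resp. A*); (ii) for 0 ≤ i ≤ d, e_i acts on V as E_{i−t} if t ≤ i ≤ t+δ, and as zero otherwise; (iii) for 0 ≤ i ≤ d, e*_i acts on V as E*_{i−r} if r ≤ i ≤ r+δ, and as zero otherwise. Moreover this T-module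 is irreducible. -/
open Polynomial

/-- Place a sequence at offset `t`: `shiftSeq P δ t i` is `P (i - t)` for `t ≤ i ≤ t + δ`, and
zero otherwise. -/
def shiftSeq {R : Type*} [Zero R] (P : ℕ → R) (δ t i : ℕ) : R :=
  if t ≤ i ∧ i ≤ t + δ then P (i - t) else 0

theorem shiftSeq_add {R : Type*} [Zero R] (P : ℕ → R) {δ i : ℕ} (t : ℕ) (hi : i ≤ δ) :
    shiftSeq P δ t (t + i) = P i := by
  simp [shiftSeq, hi]

theorem shiftSeq_eq_zero_or {R : Type*} [Zero R] (P : ℕ → R) (δ t i : ℕ) :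
    shiftSeq P δ t i = 0 ∨ ∃ j ≤ δ, i = t + j := by
  by_cases h : t ≤ i ∧ i ≤ t + δ
  · exact .inr ⟨i - t, by omega, by omega⟩
  · exact .inl (if_neg h)

theorem sum_smul_shiftSeq {F R : Type*} [Semiring F] [AddCommMonoid R] [Module F R]
    (f : ℕ → F) (P : ℕ → R) {δ t d : ℕ} (h : t + δ ≤ d) :
    ∑ i : Fin (d + 1), f i • shiftSeq P δ t i = ∑ i ∈ Finset.range (δ + 1), f (t + i) • P i := by
  rw [Fin.sum_univ_eq_sum_range fun i => f i • shiftSeq P δ t i]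
  have hsub : (Finset.range (δ + 1)).map (addLeftEmbedding t) ⊆ Finset.range (d + 1) := by
    intro i hi
    simp only [Finset.mem_map, Finset.mem_range, addLeftEmbedding_apply] at hi ⊢
    omega
  rw [← Finset.sum_subset hsub, Finset.sum_map]
  · refine Finset.sum_congr rfl fun i hi => ?_
    rw [addLeftEmbedding_apply, shiftSeq_add P t (Nat.lt_succ_iff.1 (Finset.mem_range.1 hi))]
  · intro i _ hi
    rcases shiftSeq_eq_zero_or P δ t i with h0 | ⟨j, hj, rfl⟩
    · rw [h0, smul_zero]
    · exact absurd (Finset.mem_map.2 ⟨j, Finset.mem_range.2 (by omega), rfl⟩) hi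

theorem sum_shiftSeq {R : Type*} [AddCommMonoid R] (P : ℕ → R) {δ t d : ℕ} (h : t + δ ≤ d) :
    ∑ i : Fin (d + 1), shiftSeq P δ t i = ∑ i ∈ Finset.range (δ + 1), P i := by
  simpa using sum_smul_shiftSeq (F := ℕ) (fun _ => 1) P h

theorem shiftSeq_mul {R : Type*} [MulZeroClass R] {P : ℕ → R} {δ : ℕ}
    (hP : ∀ i j, i ≤ δ → j ≤ δ → P i * P j = if i = j then P i else 0) (t i j : ℕ) :
    shiftSeq P δ t i * shiftSeq P δ t j = if i = j then shiftSeq P δ t i else 0 := by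
  rcases shiftSeq_eq_zero_or P δ t i with h | ⟨i, hi, rfl⟩
  · simp [h]
  rcases shiftSeq_eq_zero_or P δ t j with h | ⟨j, hj, rfl⟩
  · rw [h, mul_zero]
    split_ifs with hij
    · rw [hij, h]
    · rfl
  · simp [shiftSeq_add P t hi, shiftSeq_add P t hj, hP i j hi hj]

/-- A map `B` which moves each block `P_i` only to adjacent blocks satisfies `P_i B P_j = 0`
for `|i - j| > 1`. -/
theorem mul_mul_eq_zero_of_map_range_le {F V : Type*} [Field F] [AddCommGroup V] [Module F V]
    {P : ℕ → Module.End F V} {B : Module.End F V} {δ : ℕ}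
    (hP : ∀ i j, i ≤ δ → j ≤ δ → P i * P j = if i = j then P i else 0)
    (hB : ∀ i, i ≤ δ → Submodule.map B (LinearMap.range (P i)) ≤
      (if i = 0 then ⊥ else LinearMap.range (P (i - 1))) ⊔ LinearMap.range (P i) ⊔
        (if i = δ then ⊥ else LinearMap.range (P (i + 1))))
    {i j : ℕ} (hi : i ≤ δ) (hj : j ≤ δ) (hij : 1 < max (i - j) (j - i)) :
    P i * B * P j = 0 := by
  have hker : ∀ m, m ≤ δ → i ≠ m → LinearMap.range (P m) ≤ LinearMap.ker (P i) := by
    rintro m hm hne _ ⟨v, rfl⟩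
    have := hP i m hi hm
    rw [if_neg hne] at this
    exact LinearMap.congr_fun this v
  have hle := (hB j hj).trans (c := LinearMap.ker (P i)) <| by
    refine sup_le (sup_le ?_ (hker j hj (by omega))) ?_
    · split_ifs
      · exact bot_le
      · exact hker _ (by omega) (by omega)
    · split_ifs
      · exact bot_le
      · exact hker _ (by omega) (by omega)
  ext v
  exact hle ⟨P j v, ⟨v, rfl⟩, rfl⟩

theorem mul_pow_mul_eq_zero {R : Type*} [Semiring R] {P : ℕ → R} {B : R} {δ : ℕ}
    (hP : ∀ i j, i ≤ δ → j ≤ δ → P i * P j = if i = j then P i else 0)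
    (hsum : ∑ i ∈ Finset.range (δ + 1), P i = 1)
    (hB : ∀ i j, i ≤ δ → j ≤ δ → 1 < max (i - j) (j - i) → P i * B * P j = 0)
    {j : ℕ} (hj : j ≤ δ) (k : ℕ) :
    ∀ i ≤ δ, k < max (i - j) (j - i) → P i * B ^ k * P j = 0 := by
  induction k with
  | zero =>
    intro i hi hk
    rw [pow_zero, mul_one, hP i j hi hj, if_neg (by omega)]
  | succ k ih =>
    intro i hi hk
    have : P i * B ^ (k + 1) * P j =
        ∑ l ∈ Finset.range (δ + 1), P i * B * P l * (B ^ k * P j) := by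
      rw [← Finset.sum_mul, ← Finset.mul_sum, hsum, mul_one, pow_succ']
      simp only [mul_assoc]
    rw [this]
    refine Finset.sum_eq_zero fun l hl => ?_
    have hl : l ≤ δ := Nat.lt_succ_iff.1 (Finset.mem_range.1 hl)
    by_cases hil : 1 < max (i - l) (l - i)
    · rw [hB i l hi hl hil, zero_mul]
    · rw [mul_assoc, ← mul_assoc (P l), ih l hl (by omega), mul_zero]

theorem shiftSeq_mul_pow_mul_eq_zero {R : Type*} [Semiring R] {P : ℕ → R} {B : R} {δ : ℕ}
    (hP : ∀ i j, i ≤ δ → j ≤ δ → P i * P j = if i = j then P i else 0)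
    (hsum : ∑ i ∈ Finset.range (δ + 1), P i = 1)
    (hB : ∀ i j, i ≤ δ → j ≤ δ → 1 < max (i - j) (j - i) → P i * B * P j = 0)
    (t : ℕ) {i j k : ℕ} (hk : k < max (i - j) (j - i)) :
    shiftSeq P δ t i * B ^ k * shiftSeq P δ t j = 0 := by
  rcases shiftSeq_eq_zero_or P δ t i with h | ⟨i, hi, rfl⟩
  · simp [h]
  rcases shiftSeq_eq_zero_or P δ t j with h | ⟨j, hj, rfl⟩
  · simp [h]
  · rw [shiftSeq_add P t hi, shiftSeq_add P t hj]
    exact mul_pow_mul_eq_zero hP hsum hB hj k i hi (by omega)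

/-- The values of the generators of `T` under a representation. -/
def tgenVal {R : Type*} {d : ℕ} (A As : R) (e es : ℕ → R) : TGen d → R
  | .a => A
  | .astar => As
  | .e i => e i
  | .estar i => es i

/-- Given a tridiagonal system over `F` with eigenvalue sequence `{θ_i}_{i=t}^{t+δ}` and dual
eigenvalue sequence `{θ*_i}_{i=r}^{r+δ}`, its underlying vector space `V` carries a `T`-module
structure (i.e. an `F`-algebra homomorphism `T → End_F V`) on which `a`, `a*` act as `A`, `A*`,
`e_i` acts as `E_{i−t}` for `t ≤ i ≤ t+δ` and as zero otherwise, `e*_i` acts as `E*_{i−r}` for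
`r ≤ i ≤ r+δ` and as zero otherwise; moreover this `T`-module is irreducible. -/
theorem stmt4 {F : Type*} [Field F] (d : ℕ) (θ θs : ℕ → F) (h : EigCond F d θ θs)
    (δ r t : ℕ) (hδ : δ ≤ d) (hr : r ≤ d - δ) (ht : t ≤ d - δ)
    (V : Type*) [AddCommGroup V] [Module F V]
    (A As : V →ₗ[F] V) (E Es : ℕ → (V →ₗ[F] V))
    (hsys : IsTDSystem F V δ A As E Es (fun i => θ (t + i)) (fun i => θs (r + i))) :
    ∃ φ : TAlg F d θ θs →ₐ[F] Module.End F V,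
      φ (aT F d θ θs) = A ∧
      φ (asT F d θ θs) = As ∧
      (∀ i, i ≤ d → φ (eT F d θ θs i) = if t ≤ i ∧ i ≤ t + δ then E (i - t) else 0) ∧
      (∀ i, i ≤ d → φ (esT F d θ θs i) = if r ≤ i ∧ i ≤ r + δ then Es (i - r) else 0) ∧
      (∀ W : Submodule F V,
        (∀ x : TAlg F d θ θs, ∀ w ∈ W, φ x w ∈ W) → W = ⊥ ∨ W = ⊤) := by
  obtain ⟨-, -, -, -, -, -, hE, hEs, hsE, hsEs, hA, hAs, htri, htris, hirr⟩ := hsys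
  have hB : ∀ i j, i ≤ δ → j ≤ δ → 1 < max (i - j) (j - i) → E i * As * E j = 0 :=
    fun i j hi hj => mul_mul_eq_zero_of_map_range_le hE htri hi hj
  have hBs : ∀ i j, i ≤ δ → j ≤ δ → 1 < max (i - j) (j - i) → Es i * A * Es j = 0 :=
    fun i j hi hj => mul_mul_eq_zero_of_map_range_le hEs htris hi hj
  have htd : t + δ ≤ d := by omega
  have hrd : r + δ ≤ d := by omega
  let f : FreeAlgebra F (TGen d) →ₐ[F] Module.End F V :=
    FreeAlgebra.lift F (tgenVal A As (shiftSeq E δ t) (shiftSeq Es δ r))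
  have hf (g) : f (FreeAlgebra.ι F g) = tgenVal A As (shiftSeq E δ t) (shiftSeq Es δ r) g :=
    FreeAlgebra.lift_ι_apply _ _
  have hrel : ∀ ⦃x y⦄, TRel F d θ θs x y → f x = f y := by
    intro x y hxy
    induction hxy with
    | ee i j =>
      rw [map_mul, apply_ite f, map_zero, hf, hf]
      simpa only [tgenVal, Fin.val_inj] using shiftSeq_mul hE t i j
    | eses i j =>
      rw [map_mul, apply_ite f, map_zero, hf, hf]
      simpa only [tgenVal, Fin.val_inj] using shiftSeq_mul hEs r i j
    | sum_e =>
      simp only [map_sum, map_one, hf, tgenVal]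
      exact (sum_shiftSeq E htd).trans hsE
    | sum_estar =>
      simp only [map_sum, map_one, hf, tgenVal]
      exact (sum_shiftSeq Es hrd).trans hsEs
    | a_eq =>
      simp only [map_sum, map_smul, hf, tgenVal]
      exact hA.trans (sum_smul_shiftSeq θ E htd).symm
    | astar_eq =>
      simp only [map_sum, map_smul, hf, tgenVal]
      exact hAs.trans (sum_smul_shiftSeq θs Es hrd).symm
    | trid i j k _ hk =>
      simp only [map_mul, map_pow, map_zero, hf, tgenVal]
      exact shiftSeq_mul_pow_mul_eq_zero hEs hsEs hBs r hk
    | tridstar i j k _ hk =>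
      simp only [map_mul, map_pow, map_zero, hf, tgenVal]
      exact shiftSeq_mul_pow_mul_eq_zero hE hsE hB t hk
  let φ : TAlg F d θ θs →ₐ[F] Module.End F V := RingQuot.liftAlgHom F ⟨f, hrel⟩
  have hφ (g) : φ (tgen F d θ θs g) = tgenVal A As (shiftSeq E δ t) (shiftSeq Es δ r) g :=
    (RingQuot.liftAlgHom_mkAlgHom_apply F f hrel _).trans (hf g)
  refine ⟨φ, hφ _, hφ _, fun i hi => ?_, fun i hi => ?_, fun W hW => hirr W ?_ ?_⟩
  · rw [eT, dif_pos (Nat.lt_succ_of_le hi), hφ]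
    rfl
  · rw [esT, dif_pos (Nat.lt_succ_of_le hi), hφ]
    rfl
  · intro w hw
    simpa only [aT, hφ, tgenVal] using hW (aT F d θ θs) w hw
  · intro w hw
    simpa only [asT, hφ, tgenVal] using hW (asT F d θ θs) w hw
end

section
/- The intersection Te*_0 ∩ J equals Σ_{i=1}^d T g_i. -/
open Polynomial

theorem esT_zero_mul_self (F : Type*) [Field F] (d : ℕ) (θ θs : ℕ → F) :
    esT F d θ θs 0 * esT F d θ θs 0 = esT F d θ θs 0 := by
  have h := RingQuot.mkAlgHom_rel F (TRel.eses (θ := θ) (θs := θs) (0 : Fin (d + 1)) 0)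
  rw [if_pos rfl, map_mul] at h
  rw [esT, dif_pos (Nat.succ_pos d)]
  exact h

theorem gElt_mul_esT_zero (F : Type*) [Field F] (d : ℕ) (θ θs ζ : ℕ → F) (i : ℕ) :
    gElt F d θ θs ζ i * esT F d θ θs 0 = gElt F d θ θs ζ i := by
  simp only [gElt, sub_mul, smul_mul_assoc, mul_assoc, esT_zero_mul_self]

/-- In a ring with an idempotent `e`, if every element of `S` lies in the left ideal `R e`, then
`R e ∩ (R (1 - e) + R S) = R S`. -/
theorem span_idempotent_inf_span_union {R : Type*} [Ring R] {e : R} (he : e * e = e) {S : Set R}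
    (hS : ∀ g ∈ S, g * e = g) :
    Submodule.span R {e} ⊓ Submodule.span R ({1 - e} ∪ S) = Submodule.span R S := by
  have hSe : ∀ x ∈ Submodule.span R S, x * e = x := fun x hx => by
    induction hx using Submodule.span_induction with
    | mem x hx => exact hS x hx
    | zero => exact zero_mul e
    | add x y _ _ hx hy => rw [add_mul, hx, hy]
    | smul t x _ hx => rw [smul_eq_mul, mul_assoc, hx]
  refine le_antisymm ?_ (le_inf (fun x hx => ?_) (Submodule.span_mono Set.subset_union_right))
  · rintro x ⟨hx, hJ⟩
    obtain ⟨u, rfl⟩ := Submodule.mem_span_singleton.1 hx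
    rw [SetLike.mem_coe, Submodule.span_union] at hJ
    obtain ⟨y, hy, s, hs, hys⟩ := Submodule.mem_sup.1 hJ
    obtain ⟨t, rfl⟩ := Submodule.mem_span_singleton.1 hy
    have hus : u * e = s := by
      simpa only [smul_eq_mul, add_mul, mul_assoc, sub_mul, one_mul, he, sub_self, mul_zero,
        zero_add, hSe s hs, eq_comm] using congrArg (· * e) hys
    rwa [smul_eq_mul, hus]
  · exact Submodule.mem_span_singleton.2 ⟨x, hSe x hx⟩

/-- `T e*_0 ∩ J = Σ_{i=1}^d T g_i`. -/
theorem stmt7 {F : Type*} [Field F] (d : ℕ) (θ θs : ℕ → F) (h : EigCond F d θ θs)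
    (ζ : ℕ → F) (hζ : ZetaCond F d θ θs ζ) :
    Submodule.span (TAlg F d θ θs) {esT F d θ θs 0} ⊓ Jideal F d θ θs ζ =
      Submodule.span (TAlg F d θ θs) (gElt F d θ θs ζ '' Set.Icc 1 d) := by
  refine span_idempotent_inf_span_union (esT_zero_mul_self F d θ θs) ?_
  rintro _ ⟨i, -, rfl⟩
  exact gElt_mul_esT_zero F d θ θs ζ i
end
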